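/- Let r ∈ ℝ≥0, let n ∈ ℤ≥0 and let f : O_F → E be a function of class C^r on O_F. Define g : O_F → E by g(z) = 1_{D(0,n)}(z) · f(z/ϖ^n). Then g is of class C^r on O_F and ‖g‖_{C^r} ≤ q^{n r} · ‖f‖_{C^r}. -/

import Mathlib

/- Preamble: formalization of the basic objects from "Fonctions de classe C^r sur O_F"
   (C^r functions on O_F, locally analytic functions, locally J-analytic characters,
   the spaces V(χ,J,d), B(χ,J,d), the lattice Λ, etc.).

   Conventions:
   * F, E are nonarchimedean complete normed fields (abstracting finite extensions of ℚ_p);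
   * O_F is encoded by the predicate ‖·‖ ≤ 1, and functions on O_F are encoded as
     functions on F whose defining conditions only quantify over the unit ball;
   * `q` is the residue cardinality, `ϖ` a uniformizer with ‖ϖ‖ = q⁻¹,
     and D(a,n) = {z : ‖z - a‖ ≤ q^(-n)};
   * S is the (finite) set of embeddings F → E, `emb σ` the corresponding ring maps;
   * multi-indices are functions `i : S → ℕ`; a pair (k over S∖J, m over J) is encoded
     as the single multi-index agreeing with k off J and with m on J. -/

open scoped Classical Topology
open Filter

noncomputable section

namespace Paper

variable {F E : Type*} [NormedField F] [NormedField E]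
variable {S : Type*} [Fintype S]

/-- total degree |i| of a multi-index -/
def mSum (i : S → ℕ) : ℕ := ∑ σ, i σ

/-- i! -/
def mFact (i : S → ℕ) : ℕ := ∏ σ, (i σ).factorial

/-- z^i = ∏_σ σ(z)^(i_σ) -/
def mPow (emb : S → (F →+* E)) (z : F) (i : S → ℕ) : E := ∏ σ, (emb σ z) ^ (i σ)

/-- the (finite) set of multi-indices of total degree ≤ N -/
def degLE (S : Type*) [Fintype S] (N : ℕ) : Finset (S → ℕ) :=
  ((Finset.univ : Finset (S → Fin (N + 1))).image (fun i σ => (i σ : ℕ))).filter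
    (fun i => mSum i ≤ N)

/-- the remainder ε_{f,N}(x,y) = f(x+y) - Σ_{|i| ≤ N} D_i f(x) y^i / i! -/
def crRem (emb : S → (F →+* E)) (N : ℕ) (f : F → E) (Df : (S → ℕ) → F → E)
    (x y : F) : E :=
  f (x + y) - ∑ i ∈ degLE S N, Df i x * mPow emb y i / (mFact i : E)

/-- `f` is of class C^r on O_F with derivative data `Df`: the `Df i` (|i| ≤ ⌊r⌋) are
bounded on O_F and C_{f,r}(h) = sup_{x ∈ O_F, y ∈ ϖ^h O_F} |ε_{f,[r]}(x,y)| q^{rh} → 0. -/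
def IsCrWith (q : ℕ) (emb : S → (F →+* E)) (r : ℝ) (f : F → E)
    (Df : (S → ℕ) → F → E) : Prop :=
  (∀ i : S → ℕ, mSum i ≤ ⌊r⌋₊ → ∃ C : ℝ, ∀ x : F, ‖x‖ ≤ 1 → ‖Df i x‖ ≤ C) ∧
  ∀ ε : ℝ, 0 < ε → ∃ H : ℕ, ∀ h : ℕ, H ≤ h → ∀ x y : F, ‖x‖ ≤ 1 →
    ‖y‖ ≤ (q : ℝ) ^ (-(h : ℤ)) →
      ‖crRem emb ⌊r⌋₊ f Df x y‖ * (q : ℝ) ^ (r * (h : ℝ)) ≤ ε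

/-- `f` is of class C^r on O_F -/
def IsCr (q : ℕ) (emb : S → (F →+* E)) (r : ℝ) (f : F → E) : Prop :=
  ∃ Df, IsCrWith q emb r f Df

/-- the C^r norm computed from derivative data `Df` -/
def crNormWith (emb : S → (F →+* E)) (r : ℝ) (f : F → E)
    (Df : (S → ℕ) → F → E) : ℝ :=
  sSup ({x | ∃ i : S → ℕ, mSum i ≤ ⌊r⌋₊ ∧ ∃ z : F, ‖z‖ ≤ 1 ∧
          x = ‖Df i z / (mFact i : E)‖} ∪
        {x | ∃ z y : F, ‖z‖ ≤ 1 ∧ ‖y‖ ≤ 1 ∧ y ≠ 0 ∧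
          x = ‖crRem emb ⌊r⌋₊ f Df z y‖ / ‖y‖ ^ r})

/-- the C^r norm of `f` (the derivative data being unique, the set below is a singleton
when `f` is of class C^r). -/
def crNorm (q : ℕ) (emb : S → (F →+* E)) (r : ℝ) (f : F → E) : ℝ :=
  sSup {c | ∃ Df, IsCrWith q emb r f Df ∧ c = crNormWith emb r f Df}

/-- membership in the closed subspace C^r(O_F, J, d) of C^r(O_F, E):
∂^{dσ+1} f / ∂z_σ^{dσ+1} = 0 for σ ∉ J. -/
def IsCrJ (q : ℕ) (emb : S → (F →+* E)) (r : ℝ) (J : Set S) (d : S → ℕ)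
    (f : F → E) : Prop :=
  ∃ Df, IsCrWith q emb r f Df ∧
    ∀ σ : S, σ ∉ J → ∀ x : F, ‖x‖ ≤ 1 → Df (Pi.single σ (d σ + 1)) x = 0

/-- `c` is the family of Taylor coefficients of an expansion of `f` on D(a,h), with
exponents bounded by `d` off `J`, and coefficients with ‖c m‖ q^{-h|m|} → 0. -/
def IsExpansionAt (q : ℕ) (emb : S → (F →+* E)) (J : Set S) (d : S → ℕ) (h : ℕ)
    (a : F) (c : (S → ℕ) → E) (f : F → E) : Prop :=
  (∀ m : S → ℕ, ¬ (∀ σ, σ ∉ J → m σ ≤ d σ) → c m = 0) ∧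
  Tendsto (fun m : S → ℕ => ‖c m‖ * (q : ℝ) ^ (-(h : ℝ) * (mSum m : ℝ)))
    cofinite (nhds 0) ∧
  ∀ z : F, ‖z - a‖ ≤ (q : ℝ) ^ (-(h : ℤ)) →
    HasSum (fun m : S → ℕ => c m * mPow emb (z - a) m) (f z)

/-- membership in F_h(O_F, J, d) -/
def IsFh (q : ℕ) (emb : S → (F →+* E)) (J : Set S) (d : S → ℕ) (h : ℕ)
    (f : F → E) : Prop :=
  ∀ a : F, ‖a‖ ≤ 1 → ∃ c : (S → ℕ) → E, IsExpansionAt q emb J d h a c f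

/-- membership in F(O_F, J, d) = ∪_h F_h(O_F, J, d) -/
def IsF (q : ℕ) (emb : S → (F →+* E)) (J : Set S) (d : S → ℕ) (f : F → E) : Prop :=
  ∃ h : ℕ, IsFh q emb J d h f

/-- the norm of F_h(O_F, J, d) -/
def FhNorm (q : ℕ) (emb : S → (F →+* E)) (J : Set S) (d : S → ℕ) (h : ℕ)
    (f : F → E) : ℝ :=
  sSup {x | ∃ a : F, ‖a‖ ≤ 1 ∧ ∃ c : (S → ℕ) → E, IsExpansionAt q emb J d h a c f ∧
        ∃ m : S → ℕ, x = ‖c m‖ * (q : ℝ) ^ (-(h : ℝ) * (mSum m : ℝ))}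

/-- membership in F^N(O_F, J, d): member of F(O_F,J,d) which is a sum of members of the
spaces F(O_F, ∅, d'') over multi-indices d'' of total degree ≤ N. -/
def IsFN (q : ℕ) (emb : S → (F →+* E)) (J : Set S) (d : S → ℕ) (N : ℕ)
    (f : F → E) : Prop :=
  IsF q emb J d f ∧ ∃ g : (S → ℕ) → (F → E),
    (∀ m ∈ degLE S N, IsF q emb (∅ : Set S) m (g m)) ∧
    ∀ z : F, ‖z‖ ≤ 1 → f z = ∑ m ∈ degLE S N, g m z

/-- |d| = Σ_{σ ∉ J} d_σ -/
def dSum (J : Set S) (d : S → ℕ) : ℕ :=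
  ∑ σ ∈ Finset.univ.filter (fun σ => σ ∉ J), d σ

/-- z^d = ∏_{σ ∉ J} σ(z)^{d_σ} -/
def dPow (emb : S → (F →+* E)) (J : Set S) (d : S → ℕ) (z : F) : E :=
  ∏ σ ∈ Finset.univ.filter (fun σ => σ ∉ J), (emb σ z) ^ (d σ)

/-- z^{d-k} z^{-m} where (k, m) is encoded by the single multi-index `i`
(k = i off J, m = i on J). -/
def negPow (emb : S → (F →+* E)) (J : Set S) (d : S → ℕ) (i : S → ℕ) (z : F) : E :=
  (∏ σ ∈ Finset.univ.filter (fun σ => σ ∉ J), (emb σ z) ^ (d σ - i σ)) /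
    (∏ σ ∈ Finset.univ.filter (fun σ => σ ∈ J), (emb σ z) ^ (i σ))

/-- the function 1_{D(a,n)}(z) (z-a)^i -/
def test1 (q : ℕ) (emb : S → (F →+* E)) (a : F) (n : ℤ) (i : S → ℕ) : F → E :=
  fun z => if ‖z - a‖ ≤ (q : ℝ) ^ (-n) then mPow emb (z - a) i else 0

/-- the function χ2 χ1⁻¹ -/
def chRatio (χ1 χ2 : F →* E) (z : F) : E := χ2 z / χ1 z

/-- the function 1_{F∖D(a,n+1)}(z) χ2χ1⁻¹(z-a) (z-a)^{d-k} (z-a)^{-m} -/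
def test2 (q : ℕ) (emb : S → (F →+* E)) (J : Set S) (d : S → ℕ) (χ1 χ2 : F →* E)
    (a : F) (n : ℤ) (i : S → ℕ) : F → E :=
  fun z => if ‖z - a‖ ≤ (q : ℝ) ^ (-(n + 1)) then 0
    else chRatio χ1 χ2 (z - a) * negPow emb J d i (z - a)

/-- the ϖ-adic valuation v(a) (so that ‖a‖ = q^{-v(a)} for a ≠ 0) -/
def valF (q : ℕ) (a : F) : ℤ := ⌊-(Real.logb q ‖a‖)⌋

/-- the function 1_{D(1/a, n - 2v(a))}(z) χ2χ1⁻¹(z) z^d (1/z - a)^k (1/z - a)^m -/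
def test3 (q : ℕ) (emb : S → (F →+* E)) (J : Set S) (d : S → ℕ) (χ1 χ2 : F →* E)
    (a : F) (n : ℤ) (i : S → ℕ) : F → E :=
  fun z => if ‖z - a⁻¹‖ ≤ (q : ℝ) ^ (-(n - 2 * valF q a))
    then chRatio χ1 χ2 z * dPow emb J d z * mPow emb (z⁻¹ - a) i else 0

/-- locally J-analytic character: continuous on F^× and, on each disk D(a,l) around a
unit, given by a convergent power series in the variables (σ(z) - σ(a))_{σ ∈ J}. -/
def IsLocJChar (q : ℕ) (emb : S → (F →+* E)) (J : Set S) (χ : F →* E) : Prop :=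
  ContinuousOn (χ : F → E) {z : F | z ≠ 0} ∧
  ∃ l : ℕ, ∀ a : F, ‖a‖ = 1 → ∃ c : (S → ℕ) → E,
    (∀ m : S → ℕ, ¬ (∀ σ, σ ∉ J → m σ = 0) → c m = 0) ∧
    ∀ z : F, ‖z - a‖ ≤ (q : ℝ) ^ (-(l : ℤ)) →
      HasSum (fun m : S → ℕ => c m * mPow emb (z - a) m) (χ z)

/-- the valuation v_p on E normalized by v_p(p) = 1, given that ‖x‖ = p^{-ef·v_p(x)}
(ef = [F:ℚ_p]). -/
def vP (p : ℕ) (ef : ℕ) (x : E) : ℝ := -(Real.logb p ‖x‖) / (ef : ℝ)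

/-- the monomial character z ↦ ∏_{σ ∈ T} σ(z)^{d_σ} -/
def monChar (emb : S → (F →+* E)) (T : Set S) (d : S → ℕ) : F →* E where
  toFun z := ∏ σ ∈ Finset.univ.filter (fun σ => σ ∈ T), (emb σ z) ^ (d σ)
  map_one' := by simp
  map_mul' := by
    intro x y
    simp [map_mul, mul_pow, Finset.prod_mul_distrib]

/-- `g` is (on O_F ∖ {0}) the function z ↦ χ2χ1⁻¹(z) z^d f(1/z); i.e. `g` is an
extension to O_F of the second-chart transform of `f`. -/
def ExtProp (emb : S → (F →+* E)) (J : Set S) (d : S → ℕ) (χ1 χ2 : F →* E)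
    (f g : F → E) : Prop :=
  ∀ z : F, z ≠ 0 → ‖z‖ ≤ 1 → g z = chRatio χ1 χ2 z * dPow emb J d z * f z⁻¹

/-- membership in V(χ, J, d) (global sections of the locally analytic sheaf) -/
def MemV (q : ℕ) (emb : S → (F →+* E)) (J : Set S) (d : S → ℕ) (χ1 χ2 : F →* E)
    (f : F → E) : Prop :=
  IsF q emb J d f ∧ ∃ g : F → E, IsF q emb J d g ∧ ExtProp emb J d χ1 χ2 f g

/-- membership in the Banach space B(χ, J, d) -/
def MemB (q : ℕ) (emb : S → (F →+* E)) (r : ℝ) (J : Set S) (d : S → ℕ)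
    (χ1 χ2 : F →* E) (f : F → E) : Prop :=
  IsCrJ q emb r J d f ∧ ∃ g : F → E, IsCrJ q emb r J d g ∧ ExtProp emb J d χ1 χ2 f g

/-- the norm of B(χ, J, d): ‖f‖_B = max(‖f₁‖_{C^r}, ‖f₂‖_{C^r}) where
f₁(z) = f(ϖ z) and f₂ is the extension of z ↦ χ2χ1⁻¹(z) z^d f(1/z). -/
def BNorm (q : ℕ) (emb : S → (F →+* E)) (r : ℝ) (J : Set S) (d : S → ℕ)
    (χ1 χ2 : F →* E) (ϖ : F) (f : F → E) : ℝ :=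
  sSup {x | ∃ g : F → E, IsCrJ q emb r J d g ∧ ExtProp emb J d χ1 χ2 f g ∧
    x = max (crNorm q emb r (fun z => f (ϖ * z))) (crNorm q emb r g)}

/-- the ring of integers O_E as a subring of E -/
def unitBall (E : Type*) [NormedField E] [IsUltrametricDist E] : Subring E where
  carrier := {x : E | ‖x‖ ≤ 1}
  mul_mem' := by
    intro a b ha hb
    simp only [Set.mem_setOf_eq] at *
    calc ‖a * b‖ = ‖a‖ * ‖b‖ := norm_mul a b
    _ ≤ 1 * 1 := mul_le_mul ha hb (norm_nonneg b) zero_le_one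
    _ = 1 := one_mul 1
  one_mem' := by simp
  add_mem' := by
    intro a b ha hb
    simp only [Set.mem_setOf_eq] at *
    exact le_trans (IsUltrametricDist.norm_add_le_max a b) (max_le ha hb)
  zero_mem' := by simp
  neg_mem' := by
    intro a ha
    simpa using ha

instance (E : Type*) [NormedField E] [IsUltrametricDist E] :
    Algebra (unitBall E) E := (unitBall E).subtype.toAlgebra

/-- the action of the Borel element [[t, u], [0, v]] on functions -/
def borelAct (emb : S → (F →+* E)) (J : Set S) (d : S → ℕ) (χ1 χ2 : F →* E)
    (t u v : F) (f : F → E) : F → E :=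
  fun z => χ1 (t * v) * chRatio χ1 χ2 t * dPow emb J d t * f ((v * z - u) / t)

/-- the generator 1_{O_F}(z) z^k z^m -/
def genPoly (emb : S → (F →+* E)) (i : S → ℕ) : F → E :=
  fun z => if ‖z‖ ≤ 1 then mPow emb z i else 0

/-- the generator 1_{F∖O_F}(z) χ2χ1⁻¹(z) z^{d-k} z^{-m} -/
def genSing (emb : S → (F →+* E)) (J : Set S) (d : S → ℕ) (χ1 χ2 : F →* E)
    (i : S → ℕ) : F → E :=
  fun z => if ‖z‖ ≤ 1 then 0 else chRatio χ1 χ2 z * negPow emb J d i z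

/-- the generating set of Λ: Borel translates of the basic generators -/
def lambdaGens (emb : S → (F →+* E)) (J : Set S) (d : S → ℕ) (χ1 χ2 : F →* E) :
    Set (F → E) :=
  {h | ∃ t u v : F, ∃ i : S → ℕ, t ≠ 0 ∧ v ≠ 0 ∧ (∀ σ, σ ∉ J → i σ ≤ d σ) ∧
    (h = borelAct emb J d χ1 χ2 t u v (genPoly emb i) ∨
     h = borelAct emb J d χ1 χ2 t u v (genSing emb J d χ1 χ2 i))}

/-- the O_E[P]-lattice Λ -/
def Lambda [IsUltrametricDist E] (emb : S → (F →+* E)) (J : Set S) (d : S → ℕ)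
    (χ1 χ2 : F →* E) : Submodule ↥(unitBall E) (F → E) :=
  Submodule.span ↥(unitBall E) (lambdaGens emb J d χ1 χ2)

/-- the gauge (jauge) ‖f‖_Λ = inf{‖λ‖ : λ ∈ E^×, f ∈ λΛ} of a lattice Λ -/
def lamGauge [IsUltrametricDist E] (Λ : Submodule ↥(unitBall E) (F → E))
    (f : F → E) : ℝ :=
  sInf {c : ℝ | ∃ lam : E, lam ≠ 0 ∧ c = ‖lam‖ ∧ ∃ g, g ∈ Λ ∧ f = lam • g}

/-- the formula for the action of g = (a b; c d) ∈ GL₂(F):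
(g·f)(z) = χ1(det g) χ2χ1⁻¹(-cz+a) (-cz+a)^d f((dz-b)/(-cz+a)) -/
def actFormula (emb : S → (F →+* E)) (J : Set S) (d : S → ℕ) (χ1 χ2 : F →* E)
    (g : Matrix (Fin 2) (Fin 2) F) (f : F → E) : F → E :=
  fun z => χ1 (g 0 0 * g 1 1 - g 0 1 * g 1 0) *
    chRatio χ1 χ2 (-(g 1 0) * z + g 0 0) * dPow emb J d (-(g 1 0) * z + g 0 0) *
    f ((g 1 1 * z - g 0 1) / (-(g 1 0) * z + g 0 0))

/-- the action of g ∈ GL₂(F) on functions, extended by continuity (i.e. by taking the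
limit) at the singular point z = a/c when c ≠ 0. -/
def gAct (emb : S → (F →+* E)) (J : Set S) (d : S → ℕ) (χ1 χ2 : F →* E)
    (g : Matrix (Fin 2) (Fin 2) F) (f : F → E) : F → E :=
  fun z => if g 1 0 ≠ 0 ∧ z = g 0 0 / g 1 0 then
      limUnder (𝓝[≠] z) (actFormula emb J d χ1 χ2 g f)
    else actFormula emb J d χ1 χ2 g f z

/-- μ belongs to I(χ,J,d)^∨: both components of μ restrict to continuous linear forms
on each Banach space F_h(O_F,J,d). -/
def MemIdual (q : ℕ) (emb : S → (F →+* E)) (J : Set S) (d : S → ℕ) (χ1 χ2 : F →* E)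
    (ϖ : F) (μ : (F → E) →ₗ[E] E) : Prop :=
  ∀ h : ℕ, ∃ K : ℝ, ∀ f g : F → E,
    IsFh q emb J d h (fun z => f (ϖ * z)) → IsFh q emb J d h g →
    ExtProp emb J d χ1 χ2 f g →
    ‖μ f‖ ≤ K * max (FhNorm q emb J d h (fun z => f (ϖ * z))) (FhNorm q emb J d h g)

/-- ν is a continuous (= bounded) linear form on the Banach space B(χ,J,d) -/
def BBounded (q : ℕ) (emb : S → (F →+* E)) (r : ℝ) (J : Set S) (d : S → ℕ)
    (χ1 χ2 : F →* E) (ϖ : F) (ν : (F → E) →ₗ[E] E) : Prop :=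
  ∃ K : ℝ, ∀ f : F → E, MemB q emb r J d χ1 χ2 f →
    ‖ν f‖ ≤ K * BNorm q emb r J d χ1 χ2 ϖ f

/-- the function z ↦ z^k z^m (a generator of L(χ,J,d)) -/
def lFun1 (emb : S → (F →+* E)) (i : S → ℕ) : F → E := fun z => mPow emb z i

/-- the function z ↦ χ2χ1⁻¹(z-a) (z-a)^{d-k} (z-a)^{-m} (value 0 at z = a),
a generator of L(χ,J,d) -/
def lFun2 (emb : S → (F →+* E)) (J : Set S) (d : S → ℕ) (χ1 χ2 : F →* E)
    (a : F) (i : S → ℕ) : F → E :=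
  fun z => if z = a then 0 else chRatio χ1 χ2 (z - a) * negPow emb J d i (z - a)

/-- the generating set of L(χ,J,d) -/
def lGens (emb : S → (F →+* E)) (J : Set S) (d : S → ℕ) (χ1 χ2 : F →* E)
    (r : ℝ) : Set (F → E) :=
  {h | ∃ i : S → ℕ, (∀ σ, σ ∉ J → i σ ≤ d σ) ∧ (mSum i : ℝ) < r ∧
    (h = lFun1 emb i ∨ ∃ a : F, h = lFun2 emb J d χ1 χ2 a i)}

/-- the distance in B(χ,J,d) from f to the subspace L(χ,J,d), i.e. the quotient
seminorm of B(χ,J,d)/L(χ,J,d) evaluated at the image of f. -/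
def distL (q : ℕ) (emb : S → (F →+* E)) (r : ℝ) (J : Set S) (d : S → ℕ)
    (χ1 χ2 : F →* E) (ϖ : F) (f : F → E) : ℝ :=
  sInf {x | ∃ l ∈ Submodule.span E (lGens emb J d χ1 χ2 r),
    x = BNorm q emb r J d χ1 χ2 ϖ (f - l)}

/-- the GL₂(F)-stable lattice generated by Λ under the group action -/
def LambdaG [IsUltrametricDist E] (emb : S → (F →+* E)) (J : Set S) (d : S → ℕ)
    (χ1 χ2 : F →* E) : Submodule ↥(unitBall E) (F → E) :=
  Submodule.span ↥(unitBall E)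
    {h | ∃ g : Matrix (Fin 2) (Fin 2) F, g 0 0 * g 1 1 - g 0 1 * g 1 0 ≠ 0 ∧
      ∃ x, x ∈ Lambda emb J d χ1 χ2 ∧ h = gAct emb J d χ1 χ2 g x}

/-- C^{r,id} remainder for h : O_F → F -/
def crRemId (N : ℕ) (h : F → F) (Dh : ℕ → F → F) (x y : F) : F :=
  h (x + y) - ∑ i ∈ Finset.range (N + 1), Dh i x * y ^ i / (Nat.factorial i : F)

/-- h : O_F → F is of class C^{r,id} -/
def IsCrId (q : ℕ) (r : ℝ) (h : F → F) : Prop :=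
  ∃ Dh : ℕ → F → F,
    (∀ i : ℕ, i ≤ ⌊r⌋₊ → ∃ C : ℝ, ∀ x : F, ‖x‖ ≤ 1 → ‖Dh i x‖ ≤ C) ∧
    ∀ ε : ℝ, 0 < ε → ∃ K : ℕ, ∀ k : ℕ, K ≤ k → ∀ x y : F, ‖x‖ ≤ 1 →
      ‖y‖ ≤ (q : ℝ) ^ (-(k : ℤ)) → ‖crRemId ⌊r⌋₊ h Dh x y‖ * (q : ℝ) ^ (r * (k : ℝ)) ≤ ε

/-- the set of values defining the dual norm ‖μ‖_{r,d} -/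
def dualSet (q : ℕ) (emb : S → (F →+* E)) (r : ℝ) (J : Set S) (d : S → ℕ)
    (μ : (F → E) →ₗ[E] E) : Set ℝ :=
  {x | ∃ (a : F) (n : ℕ) (i : S → ℕ), ‖a‖ ≤ 1 ∧ (∀ σ, σ ∉ J → i σ ≤ d σ) ∧
    x = ‖μ (test1 q emb a (n : ℤ) i)‖ * (q : ℝ) ^ (-(n : ℝ) * (r - (mSum i : ℝ)))}

/-- the dual norm ‖μ‖_{r,d} -/
def dualNorm (q : ℕ) (emb : S → (F →+* E)) (r : ℝ) (J : Set S) (d : S → ℕ)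
    (μ : (F → E) →ₗ[E] E) : ℝ :=
  sSup (dualSet q emb r J d μ)

/-- the operator norm of μ on C^r(O_F, J, d) -/
def opNorm (q : ℕ) (emb : S → (F →+* E)) (r : ℝ) (J : Set S) (d : S → ℕ)
    (μ : (F → E) →ₗ[E] E) : ℝ :=
  sSup {x | ∃ f : F → E, IsCrJ q emb r J d f ∧ crNorm q emb r f ≠ 0 ∧
    x = ‖μ f‖ / crNorm q emb r f}


section Auxiliary

variable {F E : Type*} [NormedField F] [NormedField E] {S : Type*} [Fintype S]

lemma mem_degLE {N : ℕ} {i : S → ℕ} : i ∈ degLE S N ↔ mSum i ≤ N := by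
  simp only [degLE, Finset.mem_filter, Finset.mem_image, Finset.mem_univ, true_and,
    and_iff_right_iff_imp]
  intro h
  have hle (σ : S) : i σ < N + 1 :=
    Nat.lt_succ_of_le ((Finset.single_le_sum (fun _ _ => Nat.zero_le _)
      (Finset.mem_univ σ)).trans h)
  exact ⟨fun σ => ⟨i σ, hle σ⟩, rfl⟩

lemma norm_sub_le_max {G : Type*} [NormedField G] [IsUltrametricDist G] (x y : G) :
    ‖x - y‖ ≤ max ‖x‖ ‖y‖ := by
  simpa [sub_eq_add_neg] using IsUltrametricDist.norm_add_le_max x (-y)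

lemma norm_mPow {emb : S → (F →+* E)} (hemb : ∀ σ z, ‖emb σ z‖ = ‖z‖) (z : F) (i : S → ℕ) :
    ‖mPow emb z i‖ = ‖z‖ ^ mSum i := by
  simp [mPow, mSum, norm_prod, hemb, Finset.prod_pow_eq_pow_sum]

lemma mPow_div (emb : S → (F →+* E)) (y a : F) (i : S → ℕ) :
    mPow emb (y / a) i = mPow emb y i / mPow emb a i := by
  simp [mPow, map_div₀, div_pow, Finset.prod_div_distrib]

lemma mSum_zero : mSum (0 : S → ℕ) = 0 := by simp [mSum]

lemma mFact_zero : mFact (0 : S → ℕ) = 1 := by simp [mFact]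

lemma mPow_eq_zero {emb : S → (F →+* E)} {i : S → ℕ} (hi : i ≠ 0) : mPow emb 0 i = 0 := by
  obtain ⟨σ, hσ⟩ := Function.ne_iff.mp hi
  exact Finset.prod_eq_zero (Finset.mem_univ σ) (by simpa using hσ)

/-- The Taylor polynomial of degree `N` with derivatives `c`. -/
def taylorPoly (emb : S → (F →+* E)) (N : ℕ) (c : (S → ℕ) → E) (y : F) : E :=
  ∑ i ∈ degLE S N, c i * mPow emb y i / (mFact i : E)

lemma crRem_eq (emb : S → (F →+* E)) (N : ℕ) (f : F → E) (Df : (S → ℕ) → F → E) (x y : F) :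
    crRem emb N f Df x y = f (x + y) - taylorPoly emb N (fun i => Df i x) y := rfl

lemma taylorPoly_add (emb : S → (F →+* E)) (N : ℕ) (c d : (S → ℕ) → E) (y : F) :
    taylorPoly emb N (fun i => c i + d i) y = taylorPoly emb N c y + taylorPoly emb N d y := by
  simp only [taylorPoly, ← Finset.sum_add_distrib]
  exact Finset.sum_congr rfl fun i _ => by ring

lemma taylorPoly_sub (emb : S → (F →+* E)) (N : ℕ) (c d : (S → ℕ) → E) (y : F) :
    taylorPoly emb N (fun i => c i - d i) y = taylorPoly emb N c y - taylorPoly emb N d y := by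
  simp only [taylorPoly, ← Finset.sum_sub_distrib]
  exact Finset.sum_congr rfl fun i _ => by ring

lemma taylorPoly_mul (emb : S → (F →+* E)) (N : ℕ) (l : E) (c : (S → ℕ) → E) (y : F) :
    taylorPoly emb N (fun i => l * c i) y = l * taylorPoly emb N c y := by
  simp only [taylorPoly, Finset.mul_sum]
  exact Finset.sum_congr rfl fun i _ => by ring

lemma taylorPoly_zero_fun (emb : S → (F →+* E)) (N : ℕ) (y : F) :
    taylorPoly emb N (fun _ => 0) y = 0 := by
  simp [taylorPoly]

lemma taylorPoly_at_zero (emb : S → (F →+* E)) (N : ℕ) (c : (S → ℕ) → E) :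
    taylorPoly emb N c 0 = c 0 := by
  rw [taylorPoly, Finset.sum_eq_single (0 : S → ℕ)]
  · simp [mFact_zero, mPow]
  · intro i _ hi
    simp [mPow_eq_zero hi]
  · intro h
    exact absurd (mem_degLE.mpr (by simp [mSum_zero])) h

lemma taylorPoly_div (emb : S → (F →+* E)) (N : ℕ) (c : (S → ℕ) → E) (y a : F) :
    taylorPoly emb N c (y / a) = taylorPoly emb N (fun i => c i / mPow emb a i) y := by
  refine Finset.sum_congr rfl fun i _ => ?_
  rw [mPow_div]
  ring

lemma norm_taylorPoly_le [IsUltrametricDist E] {emb : S → (F →+* E)}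
    (hemb : ∀ σ z, ‖emb σ z‖ = ‖z‖) {N : ℕ} {c : (S → ℕ) → E} {y : F} {C : ℝ} (hC : 0 ≤ C)
    (h : ∀ i, mSum i ≤ N → ‖c i / (mFact i : E)‖ * ‖y‖ ^ mSum i ≤ C) :
    ‖taylorPoly emb N c y‖ ≤ C := by
  refine IsUltrametricDist.norm_sum_le_of_forall_le_of_nonneg hC fun i hi => ?_
  rw [mul_div_right_comm, norm_mul, norm_mPow hemb]
  exact h i (mem_degLE.mp hi)

/-- The polynomial with derivatives `c` is `o(|y|^r)`: the obstruction to the uniqueness of the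
derivative data of a function of class `C^r`. -/
def IsNullData (q : ℕ) (emb : S → (F →+* E)) (r : ℝ) (c : (S → ℕ) → E) : Prop :=
  ∀ ε : ℝ, 0 < ε → ∃ H : ℕ, ∀ h : ℕ, H ≤ h → ∀ y : F, ‖y‖ ≤ (q : ℝ) ^ (-(h : ℤ)) →
    ‖taylorPoly emb ⌊r⌋₊ c y‖ * (q : ℝ) ^ (r * (h : ℝ)) ≤ ε

namespace IsNullData

variable {q : ℕ} {emb : S → (F →+* E)} {r : ℝ} {c : (S → ℕ) → E}

lemma const_mul (hc : IsNullData q emb r c) (l : E) : IsNullData q emb r (fun i => l * c i) := by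
  intro ε hε
  have hl : 0 < ‖l‖ + 1 := by positivity
  obtain ⟨H, hH⟩ := hc (ε / (‖l‖ + 1)) (by positivity)
  refine ⟨H, fun h hh y hy => ?_⟩
  have h1 := hH h hh y hy
  rw [taylorPoly_mul, norm_mul, mul_assoc]
  calc ‖l‖ * (‖taylorPoly emb ⌊r⌋₊ c y‖ * (q : ℝ) ^ (r * (h : ℝ)))
      ≤ (‖l‖ + 1) * (ε / (‖l‖ + 1)) := by gcongr; linarith
    _ = ε := by field_simp

lemma apply_zero (hq : 1 < q) (hr : 0 ≤ r) (hc : IsNullData q emb r c) : c 0 = 0 := by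
  rw [← norm_le_zero_iff]
  refine le_of_forall_pos_le_add fun ε hε => ?_
  obtain ⟨H, hH⟩ := hc ε hε
  have h1 := hH H le_rfl 0 (by rw [norm_zero]; positivity)
  rw [taylorPoly_at_zero] at h1
  have h2 : (1 : ℝ) ≤ (q : ℝ) ^ (r * (H : ℝ)) :=
    Real.one_le_rpow (by exact_mod_cast hq.le) (by positivity)
  nlinarith [norm_nonneg (c 0)]

end IsNullData

namespace IsCrWith

variable {q : ℕ} {emb : S → (F →+* E)} {r : ℝ} {f : F → E} {Df Df' : (S → ℕ) → F → E}

lemma isNullData_sub [IsUltrametricDist E] (h₁ : IsCrWith q emb r f Df)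
    (h₂ : IsCrWith q emb r f Df') {x : F} (hx : ‖x‖ ≤ 1) :
    IsNullData q emb r (fun i => Df i x - Df' i x) := by
  intro ε hε
  obtain ⟨H₁, hH₁⟩ := h₁.2 ε hε
  obtain ⟨H₂, hH₂⟩ := h₂.2 ε hε
  refine ⟨max H₁ H₂, fun h hh y hy => ?_⟩
  have e₁ := hH₁ h (le_of_max_le_left hh) x y hx hy
  have e₂ := hH₂ h (le_of_max_le_right hh) x y hx hy
  have key : taylorPoly emb ⌊r⌋₊ (fun i => Df i x - Df' i x) y =
      crRem emb ⌊r⌋₊ f Df' x y - crRem emb ⌊r⌋₊ f Df x y := by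
    rw [taylorPoly_sub, crRem_eq, crRem_eq]; ring
  have hle : ‖taylorPoly emb ⌊r⌋₊ (fun i => Df i x - Df' i x) y‖ ≤
      max ‖crRem emb ⌊r⌋₊ f Df' x y‖ ‖crRem emb ⌊r⌋₊ f Df x y‖ := by
    rw [key]; exact norm_sub_le_max _ _
  refine (mul_le_mul_of_nonneg_right hle (by positivity)).trans ?_
  rw [max_mul_of_nonneg _ _ (by positivity)]
  exact max_le e₂ e₁

lemma add_nullData [IsUltrametricDist E] (hf : IsCrWith q emb r f Df) {c : (S → ℕ) → E}
    (hc : IsNullData q emb r c) : IsCrWith q emb r f (fun i x => Df i x + c i) := by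
  refine ⟨fun i hi => ?_, fun ε hε => ?_⟩
  · obtain ⟨C, hC⟩ := hf.1 i hi
    exact ⟨C + ‖c i‖, fun x hx => (norm_add_le _ _).trans (by gcongr; exact hC x hx)⟩
  · obtain ⟨H₁, hH₁⟩ := hf.2 ε hε
    obtain ⟨H₂, hH₂⟩ := hc ε hε
    refine ⟨max H₁ H₂, fun h hh x y hx hy => ?_⟩
    have e₁ := hH₁ h (le_of_max_le_left hh) x y hx hy
    have e₂ := hH₂ h (le_of_max_le_right hh) y hy
    have hle : ‖crRem emb ⌊r⌋₊ f (fun i x => Df i x + c i) x y‖ ≤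
        max ‖crRem emb ⌊r⌋₊ f Df x y‖ ‖taylorPoly emb ⌊r⌋₊ c y‖ := by
      rw [crRem_eq, taylorPoly_add, ← sub_sub, ← crRem_eq]
      exact norm_sub_le_max _ _
    refine (mul_le_mul_of_nonneg_right hle (by positivity)).trans ?_
    rw [max_mul_of_nonneg _ _ (by positivity)]
    exact max_le e₁ e₂

lemma apply_zero_eq (hq : 1 < q) (hr : 0 ≤ r) (hf : IsCrWith q emb r f Df) {x : F}
    (hx : ‖x‖ ≤ 1) : Df 0 x = f x := by
  rw [← sub_eq_zero, ← norm_le_zero_iff]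
  refine le_of_forall_pos_le_add fun ε hε => ?_
  obtain ⟨H, hH⟩ := hf.2 ε hε
  have h1 := hH H le_rfl x 0 hx (by rw [norm_zero]; positivity)
  rw [crRem_eq, taylorPoly_at_zero, add_zero, norm_sub_rev] at h1
  have h2 : (1 : ℝ) ≤ (q : ℝ) ^ (r * (H : ℝ)) :=
    Real.one_le_rpow (by exact_mod_cast hq.le) (by positivity)
  nlinarith [norm_nonneg (Df 0 x - f x)]

lemma exists_bound (hf : IsCrWith q emb r f Df) :
    ∃ C : ℝ, 0 ≤ C ∧ ∀ i, mSum i ≤ ⌊r⌋₊ → ∀ x : F, ‖x‖ ≤ 1 → ‖Df i x / (mFact i : E)‖ ≤ C := by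
  choose! C hC using hf.1
  refine ⟨∑ i ∈ degLE S ⌊r⌋₊, |C i / ‖(mFact i : E)‖|,
    Finset.sum_nonneg fun _ _ => abs_nonneg _, fun i hi x hx => ?_⟩
  refine le_trans ?_ (Finset.single_le_sum (f := fun i => |C i / ‖(mFact i : E)‖|)
    (fun _ _ => abs_nonneg _) (mem_degLE.mpr hi))
  rw [norm_div]
  exact (div_le_div_of_nonneg_right (hC i hi x hx) (norm_nonneg _)).trans (le_abs_self _)

variable [IsUltrametricDist F] [IsUltrametricDist E]

lemma bddAbove (hq : 1 < q) (hval : ∀ x : F, x ≠ 0 → ∃ n : ℤ, ‖x‖ = (q : ℝ) ^ n)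
    (hemb : ∀ (σ : S) (z : F), ‖emb σ z‖ = ‖z‖) (hr : 0 ≤ r) (hf : IsCrWith q emb r f Df) :
    BddAbove ({x | ∃ i : S → ℕ, mSum i ≤ ⌊r⌋₊ ∧ ∃ z : F, ‖z‖ ≤ 1 ∧
          x = ‖Df i z / (mFact i : E)‖} ∪
        {x | ∃ z y : F, ‖z‖ ≤ 1 ∧ ‖y‖ ≤ 1 ∧ y ≠ 0 ∧
          x = ‖crRem emb ⌊r⌋₊ f Df z y‖ / ‖y‖ ^ r}) := by
  have hq0 : (0 : ℝ) < q := by exact_mod_cast (zero_lt_one.trans hq)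
  have hq1 : (1 : ℝ) < q := by exact_mod_cast hq
  obtain ⟨C, hC0, hC⟩ := hf.exists_bound
  obtain ⟨H, hH⟩ := hf.2 1 one_pos
  refine BddAbove.union ⟨C, ?_⟩ ⟨max 1 (C * (q : ℝ) ^ (r * (H : ℝ))), ?_⟩
  · rintro _ ⟨i, hi, z, hz, rfl⟩
    exact hC i hi z hz
  · rintro _ ⟨z, y, hz, hy, hy0, rfl⟩
    have hyr : 0 < ‖y‖ ^ r := Real.rpow_pos_of_pos (norm_pos_iff.mpr hy0) r
    by_cases hyH : ‖y‖ ≤ (q : ℝ) ^ (-(H : ℤ))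
    · obtain ⟨m, hm⟩ := hval y hy0
      have hmH : m ≤ -(H : ℤ) := by
        rw [hm] at hyH
        exact (zpow_le_zpow_iff_right₀ hq1).mp hyH
      obtain ⟨h, rfl⟩ : ∃ h : ℕ, m = -(h : ℤ) := ⟨m.natAbs, by omega⟩
      have h1 := hH h (by omega) z y hz hm.le
      refine le_max_of_le_left ?_
      rwa [div_eq_mul_inv, hm, ← Real.rpow_intCast, ← Real.rpow_mul hq0.le,
        ← Real.rpow_neg hq0.le, show -(((-(h : ℤ) : ℤ) : ℝ) * r) = r * h by push_cast; ring]
    · rw [not_le] at hyH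
      refine le_max_of_le_right ?_
      have hrem : ‖crRem emb ⌊r⌋₊ f Df z y‖ ≤ C := by
        rw [crRem_eq]
        have hzy : ‖z + y‖ ≤ 1 := (IsUltrametricDist.norm_add_le_max _ _).trans (max_le hz hy)
        refine (norm_sub_le_max _ _).trans (max_le ?_ ?_)
        · rw [← hf.apply_zero_eq hq hr hzy]
          simpa [mFact_zero] using hC 0 (by simp [mSum_zero]) (z + y) hzy
        · refine norm_taylorPoly_le hemb hC0 fun i hi => ?_
          exact (mul_le_of_le_one_right (norm_nonneg _)
            (pow_le_one₀ (norm_nonneg _) hy)).trans (hC i hi z hz)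
      rw [div_le_iff₀ hyr]
      refine hrem.trans ?_
      rw [mul_assoc]
      refine le_mul_of_one_le_right hC0 ?_
      calc (1 : ℝ) = (q : ℝ) ^ (r * (H : ℝ)) * ((q : ℝ) ^ (-(H : ℤ))) ^ r := by
            rw [← Real.rpow_intCast, ← Real.rpow_mul hq0.le, ← Real.rpow_add hq0]
            push_cast
            rw [show r * (H : ℝ) + -(H : ℝ) * r = 0 by ring, Real.rpow_zero]
        _ ≤ _ := by gcongr

end IsCrWith

lemma crNormWith_nonneg (emb : S → (F →+* E)) (r : ℝ) (f : F → E) (Df : (S → ℕ) → F → E) :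
    0 ≤ crNormWith emb r f Df := by
  refine Real.sSup_nonneg ?_
  rintro _ (⟨i, _, z, _, rfl⟩ | ⟨z, y, _, _, _, rfl⟩) <;> positivity

lemma crNormWith_congr {emb : S → (F →+* E)} {r : ℝ} {f : F → E} {Df Df' : (S → ℕ) → F → E}
    (h : ∀ i, mSum i ≤ ⌊r⌋₊ → ∀ x : F, ‖x‖ ≤ 1 →
      Df i x / (mFact i : E) = Df' i x / (mFact i : E)) :
    crNormWith emb r f Df = crNormWith emb r f Df' := by
  have hrem (z y : F) (hz : ‖z‖ ≤ 1) :
      crRem emb ⌊r⌋₊ f Df z y = crRem emb ⌊r⌋₊ f Df' z y := by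
    unfold crRem
    congr 1
    refine Finset.sum_congr rfl fun i hi => ?_
    rw [mul_div_right_comm, mul_div_right_comm, h i (mem_degLE.mp hi) z hz]
  unfold crNormWith
  congr 2
  · ext t
    refine exists_congr fun i => and_congr_right fun hi => exists_congr fun z =>
      and_congr_right fun hz => ?_
    rw [h i hi z hz]
  · ext t
    refine exists_congr fun z => exists_congr fun y => and_congr_right fun hz => ?_
    rw [hrem z y hz]

section Norm

variable [IsUltrametricDist E] {q : ℕ} {emb : S → (F →+* E)} {r : ℝ}

/-- If the derivative data are unique, the norm can be computed from any of them. -/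
lemma crNorm_eq_crNormWith
    (huniq : ∀ c, IsNullData q emb r c → ∀ i, mSum i ≤ ⌊r⌋₊ → c i / (mFact i : E) = 0)
    {f : F → E} {Df : (S → ℕ) → F → E} (hf : IsCrWith q emb r f Df) :
    crNorm q emb r f = crNormWith emb r f Df := by
  have hset : {c | ∃ Df, IsCrWith q emb r f Df ∧ c = crNormWith emb r f Df} =
      {crNormWith emb r f Df} := by
    refine Set.eq_singleton_iff_unique_mem.mpr ⟨⟨Df, hf, rfl⟩, ?_⟩
    rintro _ ⟨Df', hf', rfl⟩
    refine crNormWith_congr fun i hi x hx => ?_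
    rw [← sub_eq_zero, ← sub_div]
    exact huniq _ (hf'.isNullData_sub hf hx) i hi
  rw [crNorm, hset, csSup_singleton]

/-- If the derivative data are not unique, they are unbounded and `crNorm` takes its default
value. -/
lemma crNorm_eq_zero [IsUltrametricDist F] (hq : 1 < q) {ϖ : F} (hϖ : ‖ϖ‖ = (q : ℝ)⁻¹)
    (hval : ∀ x : F, x ≠ 0 → ∃ n : ℤ, ‖x‖ = (q : ℝ) ^ n)
    (hemb : ∀ (σ : S) (z : F), ‖emb σ z‖ = ‖z‖) (hr : 0 ≤ r)
    {c : (S → ℕ) → E} (hc : IsNullData q emb r c) {i : S → ℕ} (hi : mSum i ≤ ⌊r⌋₊)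
    (hci : c i / (mFact i : E) ≠ 0) {f : F → E} {Df : (S → ℕ) → F → E}
    (hf : IsCrWith q emb r f Df) :
    crNorm q emb r f = 0 := by
  refine Real.sSup_of_not_bddAbove ?_
  rintro ⟨B, hB⟩
  have hi0 : i ≠ 0 := by
    rintro rfl
    simp [hc.apply_zero hq hr] at hci
  obtain ⟨σ, -⟩ := Function.ne_iff.mp hi0
  have hpos : 0 < ‖c i / (mFact i : E)‖ := norm_pos_iff.mpr hci
  have hq1 : (1 : ℝ) < q := by exact_mod_cast hq
  obtain ⟨k, hk⟩ := pow_unbounded_of_one_lt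
    ((B + ‖Df i 0 / (mFact i : E)‖) / ‖c i / (mFact i : E)‖) hq1
  set l : E := emb σ (ϖ⁻¹ ^ k) with hl
  have hl_norm : ‖l‖ = (q : ℝ) ^ k := by
    rw [hl, hemb, norm_pow, norm_inv, hϖ, inv_inv]
  have hf' := hf.add_nullData (hc.const_mul l)
  have h1 : ‖(Df i 0 + l * c i) / (mFact i : E)‖ ≤ B :=
    (le_csSup (hf'.bddAbove hq hval hemb hr) (Or.inl ⟨i, hi, 0, by simp, rfl⟩)).trans
      (hB ⟨_, hf', rfl⟩)
  rw [div_lt_iff₀ hpos, ← hl_norm, ← norm_mul] at hk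
  have h2 : ‖l * (c i / (mFact i : E))‖ ≤
      ‖(Df i 0 + l * c i) / (mFact i : E)‖ + ‖Df i 0 / (mFact i : E)‖ := by
    refine le_trans (le_of_eq ?_) (norm_sub_le _ _)
    congr 1
    ring
  linarith

end Norm

section ExtendByZero

/-- The function `z ↦ f (z / a)` on the disk of radius `‖a‖`, extended by zero. -/
def rescale (a : F) (f : F → E) (z : F) : E := if ‖z‖ ≤ ‖a‖ then f (z / a) else 0

/-- Derivative data for `rescale a f`. -/
def rescaleDeriv (emb : S → (F →+* E)) (a : F) (Df : (S → ℕ) → F → E) (i : S → ℕ) (z : F) : E :=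
  if ‖z‖ ≤ ‖a‖ then Df i (z / a) / mPow emb a i else 0

variable {a : F} {f : F → E} {Df : (S → ℕ) → F → E} {emb : S → (F →+* E)} {N : ℕ} {x y : F}

lemma norm_div_le_one (hx : ‖x‖ ≤ ‖a‖) : ‖x / a‖ ≤ 1 := by
  rw [norm_div]
  exact div_le_one_of_le₀ hx (norm_nonneg _)

lemma crRem_rescale_of_norm_le (hx : ‖x‖ ≤ ‖a‖) (hxy : ‖x + y‖ ≤ ‖a‖) :
    crRem emb N (rescale a f) (rescaleDeriv emb a Df) x y =
      crRem emb N f Df (x / a) (y / a) := by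
  rw [crRem_eq, crRem_eq, taylorPoly_div]
  simp [rescale, rescaleDeriv, hx, hxy, add_div]

lemma crRem_rescale_of_lt_norm (hx : ‖a‖ < ‖x‖) :
    crRem emb N (rescale a f) (rescaleDeriv emb a Df) x y = rescale a f (x + y) := by
  rw [crRem_eq]
  simp [rescaleDeriv, hx.not_ge, taylorPoly_zero_fun]

variable [IsUltrametricDist F]

lemma rescale_add_eq_zero (hx : ‖a‖ < ‖x‖) (hy : ‖y‖ ≤ ‖a‖) : rescale a f (x + y) = 0 := by
  refine if_neg fun h => hx.not_ge ?_
  have := (norm_sub_le_max (x + y) y).trans (max_le h hy)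
  rwa [add_sub_cancel_right] at this

variable {q : ℕ} {r : ℝ}

lemma IsCrWith.rescale (hq : 1 < q) {n : ℕ} (ha : ‖a‖ = (q : ℝ) ^ (-(n : ℤ)))
    (hf : IsCrWith q emb r f Df) :
    IsCrWith q emb r (rescale a f) (rescaleDeriv emb a Df) := by
  have hq0 : (0 : ℝ) < q := by exact_mod_cast (zero_lt_one.trans hq)
  have hq1 : (1 : ℝ) < q := by exact_mod_cast hq
  have ha0 : 0 < ‖a‖ := by rw [ha]; positivity
  refine ⟨fun i hi => ?_, fun ε hε => ?_⟩
  · obtain ⟨C, hC⟩ := hf.1 i hi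
    have hC0 : 0 ≤ C := (norm_nonneg _).trans (hC 0 (by simp))
    refine ⟨C / ‖mPow emb a i‖, fun x _ => ?_⟩
    unfold rescaleDeriv
    split_ifs with hx
    · rw [norm_div]
      gcongr
      exact hC _ (norm_div_le_one hx)
    · rw [norm_zero]
      positivity
  · obtain ⟨H, hH⟩ := hf.2 (ε / (q : ℝ) ^ (r * (n : ℝ))) (by positivity)
    refine ⟨H + n, fun h hh x y _ hy => ?_⟩
    obtain ⟨m, rfl⟩ : ∃ m, h = m + n := ⟨h - n, by omega⟩
    have hya : ‖y‖ ≤ ‖a‖ := by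
      rw [ha]
      exact hy.trans ((zpow_le_zpow_iff_right₀ hq1).mpr (by push_cast; omega))
    rcases le_or_gt ‖x‖ ‖a‖ with hx | hx
    · have hxy : ‖x + y‖ ≤ ‖a‖ := (IsUltrametricDist.norm_add_le_max _ _).trans (max_le hx hya)
      have hdiv : ‖y / a‖ ≤ (q : ℝ) ^ (-(m : ℤ)) := by
        rw [norm_div, div_le_iff₀ ha0, ha, ← zpow_add₀ hq0.ne']
        refine hy.trans (le_of_eq ?_)
        congr 1
        push_cast
        ring
      have h1 := hH m (by omega) _ _ (norm_div_le_one hx) hdiv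
      rw [crRem_rescale_of_norm_le hx hxy]
      rw [le_div_iff₀ (by positivity), mul_assoc, ← Real.rpow_add hq0] at h1
      rwa [Nat.cast_add, mul_add]
    · rw [crRem_rescale_of_lt_norm hx, rescale_add_eq_zero hx hya, norm_zero, zero_mul]
      exact hε.le

lemma crNormWith_rescale_le [IsUltrametricDist E] (hq : 1 < q)
    (hval : ∀ x : F, x ≠ 0 → ∃ n : ℤ, ‖x‖ = (q : ℝ) ^ n)
    (hemb : ∀ (σ : S) (z : F), ‖emb σ z‖ = ‖z‖) (ha : a ≠ 0) (ha1 : ‖a‖ ≤ 1) (hr : 0 ≤ r)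
    (hf : IsCrWith q emb r f Df) :
    crNormWith emb r (rescale a f) (rescaleDeriv emb a Df) ≤
      ‖a‖ ^ (-r) * crNormWith emb r f Df := by
  set M := crNormWith emb r f Df with hM
  have hM0 : 0 ≤ M := crNormWith_nonneg _ _ _ _
  have ha0 : 0 < ‖a‖ := norm_pos_iff.mpr ha
  have hbdd := hf.bddAbove hq hval hemb hr
  have hD (i : S → ℕ) (hi : mSum i ≤ ⌊r⌋₊) (z : F) (hz : ‖z‖ ≤ 1) :
      ‖Df i z / (mFact i : E)‖ ≤ M := le_csSup hbdd (Or.inl ⟨i, hi, z, hz, rfl⟩)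
  have hR (z y : F) (hz : ‖z‖ ≤ 1) (hy : ‖y‖ ≤ 1) (hy0 : y ≠ 0) :
      ‖crRem emb ⌊r⌋₊ f Df z y‖ / ‖y‖ ^ r ≤ M := le_csSup hbdd (Or.inr ⟨z, y, hz, hy, hy0, rfl⟩)
  have hdeg {i : S → ℕ} (hi : mSum i ≤ ⌊r⌋₊) : (mSum i : ℝ) ≤ r :=
    (Nat.cast_le.mpr hi).trans (Nat.floor_le hr)
  have hDg (i : S → ℕ) (hi : mSum i ≤ ⌊r⌋₊) (z : F) :
      ‖rescaleDeriv emb a Df i z / (mFact i : E)‖ ≤ ‖a‖ ^ (-(mSum i : ℝ)) * M := by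
    unfold rescaleDeriv
    split_ifs with hz
    · rw [div_right_comm, norm_div, norm_mPow hemb, Real.rpow_neg ha0.le, Real.rpow_natCast,
        div_eq_inv_mul]
      gcongr
      exact hD i hi _ (norm_div_le_one hz)
    · rw [zero_div, norm_zero]
      positivity
  have hone : 1 ≤ ‖a‖ ^ (-r) := Real.one_le_rpow_of_pos_of_le_one_of_nonpos ha0 ha1 (by linarith)
  refine Real.sSup_le ?_ (by positivity)
  rintro _ (⟨i, hi, z, hz, rfl⟩ | ⟨x, y, hx, hy, hy0, rfl⟩)
  · refine (hDg i hi z).trans ?_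
    gcongr ?_ * M
    exact Real.rpow_le_rpow_of_exponent_ge ha0 ha1 (by linarith [hdeg hi])
  have hy0' : 0 < ‖y‖ := norm_pos_iff.mpr hy0
  rcases le_or_gt ‖y‖ ‖a‖ with hya | hya
  · rcases le_or_gt ‖x‖ ‖a‖ with hxa | hxa
    · have hxy : ‖x + y‖ ≤ ‖a‖ := (IsUltrametricDist.norm_add_le_max _ _).trans (max_le hxa hya)
      have h1 := hR (x / a) (y / a) (norm_div_le_one hxa) (norm_div_le_one hya)
        (div_ne_zero hy0 ha)
      rw [crRem_rescale_of_norm_le hxa hxy]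
      refine le_trans (le_of_eq ?_) (mul_le_mul_of_nonneg_left h1 (by positivity))
      rw [norm_div y, Real.div_rpow hy0'.le ha0.le, Real.rpow_neg ha0.le]
      have : ‖a‖ ^ r ≠ 0 := (Real.rpow_pos_of_pos ha0 r).ne'
      field_simp
    · rw [crRem_rescale_of_lt_norm hxa, rescale_add_eq_zero hxa hya, norm_zero, zero_div]
      positivity
  · have hyr : ‖y‖ ^ (-r) ≤ ‖a‖ ^ (-r) :=
      Real.rpow_le_rpow_of_nonpos ha0 hya.le (by linarith)
    rcases le_or_gt ‖x‖ ‖a‖ with hxa | hxa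
    · have hg : rescale a f (x + y) = 0 := by
        rw [add_comm]; exact rescale_add_eq_zero hya hxa
      rw [div_le_iff₀ (by positivity), crRem_eq, hg, zero_sub, norm_neg]
      refine norm_taylorPoly_le hemb (by positivity) fun i hi => ?_
      have h2 : ‖y‖ ^ ((mSum i : ℝ) - r) ≤ ‖a‖ ^ ((mSum i : ℝ) - r) :=
        Real.rpow_le_rpow_of_nonpos ha0 hya.le (by linarith [hdeg hi])
      calc _ ≤ ‖a‖ ^ (-(mSum i : ℝ)) * M * ‖y‖ ^ mSum i := by
            gcongr
            exact hDg i hi x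
        _ = ‖a‖ ^ (-(mSum i : ℝ)) * M * (‖y‖ ^ ((mSum i : ℝ) - r) * ‖y‖ ^ r) := by
            rw [← Real.rpow_add hy0', sub_add_cancel, Real.rpow_natCast]
        _ ≤ ‖a‖ ^ (-(mSum i : ℝ)) * M * (‖a‖ ^ ((mSum i : ℝ) - r) * ‖y‖ ^ r) := by gcongr
        _ = (‖a‖ ^ (-(mSum i : ℝ)) * ‖a‖ ^ ((mSum i : ℝ) - r)) * M * ‖y‖ ^ r := by ring
        _ = _ := by
            rw [← Real.rpow_add ha0]
            congr 3
            ring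
    · rw [crRem_rescale_of_lt_norm hxa, div_eq_inv_mul, ← Real.rpow_neg hy0'.le]
      gcongr
      unfold rescale
      split_ifs with hxy
      · rw [← hf.apply_zero_eq hq hr (norm_div_le_one hxy)]
        simpa [mFact_zero] using hD 0 (by simp [mSum_zero]) _ (norm_div_le_one hxy)
      · rwa [norm_zero]

end ExtendByZero

end Auxiliary

/-- Lemme 3.3 / "corollarioutile": let r ∈ ℝ≥0, n ∈ ℤ≥0 and f : O_F → E
of class C^r.  If g(z) = 1_{D(0,n)}(z) · f(z/ϖ^n), then g is of class C^r on O_F and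
‖g‖_{C^r} ≤ q^{n r} · ‖f‖_{C^r}. -/
theorem statement0
    {q : ℕ} (hq : 1 < q)
    {F E : Type*} [NormedField F] [NormedField E]
    [IsUltrametricDist F] [IsUltrametricDist E]
    [CompleteSpace F] [CompleteSpace E]
    (ϖ : F) (hϖ : ‖ϖ‖ = (q : ℝ)⁻¹)
    (hval : ∀ x : F, x ≠ 0 → ∃ n : ℤ, ‖x‖ = (q : ℝ) ^ n)
    (hres : ∀ (a : F) (n : ℤ), ∃ R : Finset F, R.card = q ∧
      (∀ x ∈ R, ‖x - a‖ ≤ (q : ℝ) ^ (-n)) ∧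
      ∀ z : F, ‖z - a‖ ≤ (q : ℝ) ^ (-n) → ∃! x, x ∈ R ∧ ‖z - x‖ ≤ (q : ℝ) ^ (-(n + 1)))
    {S : Type*} [Fintype S] (emb : S → (F →+* E))
    (hemb : ∀ (σ : S) (z : F), ‖emb σ z‖ = ‖z‖)
    (r : ℝ) (hr : 0 ≤ r) (n : ℕ) (f : F → E) (hf : IsCr q emb r f) :
    IsCr q emb r
      (fun z : F => if ‖z‖ ≤ (q : ℝ) ^ (-(n : ℤ)) then f (z / ϖ ^ n) else 0) ∧
    crNorm q emb r
      (fun z : F => if ‖z‖ ≤ (q : ℝ) ^ (-(n : ℤ)) then f (z / ϖ ^ n) else 0) ≤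
      (q : ℝ) ^ ((n : ℝ) * r) * crNorm q emb r f := by
  obtain ⟨Df, hf⟩ := hf
  have hq0 : (0 : ℝ) < q := by exact_mod_cast (zero_lt_one.trans hq)
  have ha : ‖ϖ ^ n‖ = (q : ℝ) ^ (-(n : ℤ)) := by
    rw [norm_pow, hϖ, inv_pow, zpow_neg, zpow_natCast]
  have ha0 : ϖ ^ n ≠ 0 := by
    rw [← norm_pos_iff, ha]
    positivity
  have ha1 : ‖ϖ ^ n‖ ≤ 1 := by
    rw [ha]
    exact zpow_le_one_of_nonpos₀ (by exact_mod_cast hq.le) (by omega)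
  have hg : (fun z : F => if ‖z‖ ≤ (q : ℝ) ^ (-(n : ℤ)) then f (z / ϖ ^ n) else 0) =
      rescale (ϖ ^ n) f := by
    funext z
    rw [rescale, ha]
  have hpow : (q : ℝ) ^ ((n : ℝ) * r) = ‖ϖ ^ n‖ ^ (-r) := by
    rw [ha, ← Real.rpow_intCast, ← Real.rpow_mul hq0.le]
    congr 1
    push_cast
    ring
  have hgf := hf.rescale hq ha
  rw [hg, hpow]
  refine ⟨⟨_, hgf⟩, ?_⟩
  by_cases huniq : ∀ c, IsNullData q emb r c → ∀ i, mSum i ≤ ⌊r⌋₊ → c i / (mFact i : E) = 0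
  · rw [crNorm_eq_crNormWith huniq hgf, crNorm_eq_crNormWith huniq hf]
    exact crNormWith_rescale_le hq hval hemb ha0 ha1 hr hf
  · push Not at huniq
    obtain ⟨c, hc, i, hi, hci⟩ := huniq
    rw [crNorm_eq_zero hq hϖ hval hemb hr hc hi hci hgf,
      crNorm_eq_zero hq hϖ hval hemb hr hc hi hci hf, mul_zero]
end Paper
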